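/- arXiv:math/0612187 — 2 statements merged into one kernel-verified Lean document; each statement's English description precedes it below -/
import Mathlib

section
/- Let r ≥ 1 and n ≥ 0, and set μ_r = 1 + w^{r/2} if r is even and μ_r = 1 if r is odd. Then in ℚ[u,v,w], f_{r,1,n}(u,v,w) = Σ_{j=⌈n/2⌉}^{n} (n−j)!·C(n; n−j, n−j, 2j−n)·u^{2j−n}·(v + (r−1)w^r)^{n−j}·μ_r^{2j−n} / 2^{n−j}. -/
open Finset MvPolynomial

/-- The colored permutation group `G_{r,n}`: pairs `(z, τ)` with `z : (ℤ/rℤ)ⁿ`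
and `τ` a permutation of `[n]`. -/
abbrev ColoredPerm (r n : ℕ) : Type := (Fin n → ZMod r) × Equiv.Perm (Fin n)

/-- Multiplication in `G_{r,n}`:
`(z, τ)(z', τ') = ((zᵢ + z'_{τ⁻¹(i)})ᵢ, τ ∘ τ')`. -/
def cpMul {r n : ℕ} (x y : ColoredPerm r n) : ColoredPerm r n :=
  (fun i => x.1 i + y.1 (x.2⁻¹ i), x.2 * y.2)

/-- The identity element of `G_{r,n}`. -/
def cpOne (r n : ℕ) : ColoredPerm r n := (fun _ => 0, 1)

/-- `π` is an involution: `π² = 1`. -/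
def IsCPInvolution {r n : ℕ} (π : ColoredPerm r n) : Prop := cpMul π π = cpOne r n

instance {r n : ℕ} (π : ColoredPerm r n) : Decidable (IsCPInvolution π) :=
  decidable_of_iff (cpMul π π = cpOne r n) Iff.rfl

/-- `csum π = Σᵢ zᵢ(π)`, each color regarded as an integer in `{0, …, r−1}`. -/
def csum {r n : ℕ} (π : ColoredPerm r n) : ℕ := ∑ i, (π.1 i).val

/-- `fix π`: the number of absolute fixed points, `#{i ∈ [n] : τ(i) = i}`. -/
noncomputable def fixc {r n : ℕ} (π : ColoredPerm r n) : ℕ := Nat.card {i : Fin n // π.2 i = i}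

/-- `exc_A π = #{i ∈ {1, …, n−1} : z_{τ(i)}(π) = 0 and τ(i) > i}`
(`Fin n` encodes `[n]` via `i ↦ i + 1`, so `i ∈ {1, …, n−1}` reads `(i : ℕ) + 1 < n`). -/
noncomputable def excA {r n : ℕ} (π : ColoredPerm r n) : ℕ :=
  Nat.card {i : Fin n // (i : ℕ) + 1 < n ∧ π.1 (π.2 i) = 0 ∧ i < π.2 i}

/-- The colored excedance number `exc^Clr π = r·exc_A π + csum π`. -/
noncomputable def excClr {r n : ℕ} (π : ColoredPerm r n) : ℕ := r * excA π + csum π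

/-- `f_{r,p,n}(u,v,w) = Σ_{π ∈ I_{r,p,n}} u^{fix π} v^{exc_A π} w^{csum π}`,
regarded in `ℚ[u,v,w]`, where `I_{r,p,n}` is the set of involutions `π` of
`G_{r,n}` with `csum π ≡ 0 (mod p)`; the variables `u, v, w` are `X 0, X 1, X 2`. -/
noncomputable def fpolyQ (r p n : ℕ) [NeZero r] : MvPolynomial (Fin 3) ℚ :=
  ∑ π : ColoredPerm r n,
    if IsCPInvolution π ∧ p ∣ csum π then
      X 0 ^ fixc π * X 1 ^ excA π * X 2 ^ csum π
    else 0

/-- The multinomial coefficient `C(n; a₁, …, a_k) = n!/(a₁!⋯a_k!)` when all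
entries are nonnegative and sum to `n`, and `0` otherwise. -/
def multinomialZ (n : ℤ) (l : List ℤ) : ℕ :=
  if (∀ a ∈ l, 0 ≤ a) ∧ l.sum = n then
    n.toNat.factorial / (l.map fun a => a.toNat.factorial).prod
  else 0

/-- `μ_r = 1 + w^{r/2}` for even `r` and `μ_r = 1` for odd `r`, in `ℚ[u,v,w]`. -/
noncomputable def muQ (r : ℕ) : MvPolynomial (Fin 3) ℚ :=
  if Even r then 1 + X 2 ^ (r / 2) else 1

theorem isCPInvolution_iff {r n : ℕ} (z : Fin n → ZMod r) (τ : Equiv.Perm (Fin n)) :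
    IsCPInvolution (z, τ) ↔ τ * τ = 1 ∧ ∀ i, z i + z (τ i) = 0 := by
  simp only [IsCPInvolution, cpMul, cpOne, Prod.mk.injEq, funext_iff]
  constructor
  · rintro ⟨h, hτ⟩
    rw [inv_eq_of_mul_eq_one_left hτ] at h
    exact ⟨hτ, h⟩
  · rintro ⟨hτ, h⟩
    rw [inv_eq_of_mul_eq_one_left hτ]
    exact ⟨h, hτ⟩

theorem ZMod.add_self_eq_zero_iff_val {r : ℕ} [NeZero r] (c : ZMod r) :
    c + c = 0 ↔ c.val = 0 ∨ 2 * c.val = r := by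
  have hlt := ZMod.val_lt c
  rw [← ZMod.val_eq_zero, ZMod.val_add]
  constructor
  · intro h
    obtain ⟨k, hk⟩ := Nat.dvd_of_mod_eq_zero h
    have hk2 : k < 2 := by
      by_contra! hk2
      have := Nat.mul_le_mul_left r hk2
      omega
    interval_cases k <;> omega
  · rintro (h | h)
    · simp [h]
    · rw [← two_mul, h, Nat.mod_self]

theorem sum_pow_val_add_self_eq_zero (r : ℕ) [NeZero r] :
    ∑ c : ZMod r with c + c = 0, (X 2 : MvPolynomial (Fin 3) ℚ) ^ c.val = muQ r := by
  have hr := NeZero.pos r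
  unfold muQ
  split_ifs with he
  · obtain ⟨m, hm⟩ := he
    have hv : ((m : ℕ) : ZMod r).val = m := ZMod.val_natCast_of_lt (by omega)
    have hs : ({c : ZMod r | c + c = 0} : Finset (ZMod r)) = {0, ((m : ℕ) : ZMod r)} := by
      ext c
      simp only [mem_filter, mem_univ, true_and, mem_insert, mem_singleton]
      rw [ZMod.add_self_eq_zero_iff_val, ZMod.val_eq_zero]
      refine or_congr_right ⟨fun h => ZMod.val_injective r ?_, fun h => ?_⟩
      · omega
      · rw [h, hv]; omega
    have hne : (0 : ZMod r) ≠ ((m : ℕ) : ZMod r) := by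
      intro h
      have := congrArg ZMod.val h
      rw [hv, ZMod.val_zero] at this
      omega
    rw [hs, sum_pair hne, hv, ZMod.val_zero, pow_zero, show r / 2 = m by omega]
  · have hs : ({c : ZMod r | c + c = 0} : Finset (ZMod r)) = {0} := by
      ext c
      simp only [mem_filter, mem_univ, true_and, mem_singleton]
      rw [ZMod.add_self_eq_zero_iff_val, ZMod.val_eq_zero]
      refine or_iff_left fun h => he ⟨c.val, by omega⟩
    rw [hs, sum_singleton, ZMod.val_zero, pow_zero]

theorem sum_ite_eq_zero_pow (r : ℕ) [NeZero r] :
    ∑ c : ZMod r, (if c = 0 then (X 1 : MvPolynomial (Fin 3) ℚ) else X 2 ^ r) =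
      X 1 + ((r - 1 : ℕ) : MvPolynomial (Fin 3) ℚ) * X 2 ^ r := by
  rw [← Finset.add_sum_erase _ _ (mem_univ (0 : ZMod r)), if_pos rfl,
    Finset.sum_congr rfl (fun c hc => if_neg (Finset.ne_of_mem_erase hc)), sum_const,
    card_erase_of_mem (mem_univ _), card_univ, ZMod.card, nsmul_eq_mul]

/-- Splitting a product over the points of an involution into fixed points and two-cycles. -/
theorem prod_univ_eq_of_mul_self {M : Type*} [CommMonoid M] {n : ℕ} (τ : Equiv.Perm (Fin n))
    (hτ : τ * τ = 1) (f : Fin n → M) :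
    ∏ i, f i = (∏ i with τ i = i, f i) * ∏ i with i < τ i, f i * f (τ i) := by
  have h2 : ∀ i, τ (τ i) = i := fun i => by rw [← Equiv.Perm.mul_apply, hτ]; rfl
  have h3 : ∏ i with τ i < i, f i = ∏ i with i < τ i, f (τ i) :=
    prod_nbij' τ τ (by simp [h2]) (by simp [h2]) (by simp [h2]) (by simp [h2]) (by simp [h2])
  rw [prod_mul_distrib, ← h3, prod_filter, prod_filter, prod_filter, ← prod_mul_distrib,
    ← prod_mul_distrib]
  refine prod_congr rfl fun i _ => ?_
  rcases lt_trichotomy (τ i) i with h | h | h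
  · simp [h, h.ne, h.not_gt]
  · simp [h]
  · simp [h, h.ne', h.not_gt]

/-- The weight of a colored involution factors over the cycles of its permutation. -/
theorem weight_eq_prod {r n : ℕ} [NeZero r] (τ : Equiv.Perm (Fin n)) (hτ : τ * τ = 1)
    (z : Fin n → ZMod r) (hz : ∀ i, z i + z (τ i) = 0) :
    (X 0 ^ fixc (z, τ) * X 1 ^ excA (z, τ) * X 2 ^ csum (z, τ) : MvPolynomial (Fin 3) ℚ) =
      (∏ i with τ i = i, X 0 * X 2 ^ (z i).val) *
        ∏ i with i < τ i, if z i = 0 then X 1 else X 2 ^ r := by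
  have hfix : fixc (z, τ) = #{i | τ i = i} := by
    rw [fixc, Nat.card_eq_fintype_card, Fintype.card_subtype]
  have hneg : ∀ i, z (τ i) = -z i := fun i => (neg_eq_of_add_eq_zero_right (hz i)).symm
  have hexc : excA (z, τ) = #{i ∈ ({i | i < τ i} : Finset (Fin n)) | z i = 0} := by
    rw [excA, Nat.card_eq_fintype_card, Fintype.card_subtype, filter_filter]
    congr 1
    ext i
    simp only [mem_filter, mem_univ, true_and, hneg, neg_eq_zero]
    constructor
    · rintro ⟨_, h⟩; exact h.symm
    · rintro ⟨h, h0⟩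
      have := (τ i).isLt
      rw [Fin.lt_def] at h
      exact ⟨by omega, h0, h⟩
  rw [hfix, hexc, csum, ← prod_pow_eq_pow_sum, prod_univ_eq_of_mul_self τ hτ, ← prod_const (X 0),
    ← prod_const (X 1), prod_filter (fun i => z i = 0), mul_mul_mul_comm,
    ← prod_mul_distrib, ← prod_mul_distrib]
  congr 1
  refine prod_congr rfl fun i _ => ?_
  simp only [hneg, ← pow_add, ZMod.neg_val]
  have := ZMod.val_lt (z i)
  split_ifs with h
  · simp [h]
  · rw [one_mul, Nat.add_sub_cancel' this.le]

/-- Summing over all colorings that make a given involution a colored involution. -/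
theorem sum_colorings {r n : ℕ} [NeZero r] (τ : Equiv.Perm (Fin n)) (hτ : τ * τ = 1) :
    ∑ z : Fin n → ZMod r with ∀ i, z i + z (τ i) = 0,
      (X 0 ^ fixc (z, τ) * X 1 ^ excA (z, τ) * X 2 ^ csum (z, τ) : MvPolynomial (Fin 3) ℚ) =
    (X 0 * muQ r) ^ #{i | τ i = i} *
      (X 1 + ((r - 1 : ℕ) : MvPolynomial (Fin 3) ℚ) * X 2 ^ r) ^ #{i | i < τ i} := by
  have h2 : ∀ i, τ (τ i) = i := fun i => by rw [← Equiv.Perm.mul_apply, hτ]; rfl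
  set t : Fin n → Finset (ZMod r) := fun i =>
    if τ i = i then ({c | c + c = 0} : Finset (ZMod r)) else if i < τ i then univ else {0} with ht
  set g : Fin n → ZMod r → MvPolynomial (Fin 3) ℚ := fun i c =>
    (if τ i = i then X 0 * X 2 ^ c.val else 1) *
      (if i < τ i then (if c = 0 then X 1 else X 2 ^ r) else 1) with hg
  have hgt : ∏ i, ∑ c ∈ t i, g i c = (X 0 * muQ r) ^ #{i | τ i = i} *
      (X 1 + ((r - 1 : ℕ) : MvPolynomial (Fin 3) ℚ) * X 2 ^ r) ^ #{i | i < τ i} := by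
    rw [← prod_const, ← prod_const, prod_filter, prod_filter, ← prod_mul_distrib]
    refine prod_congr rfl fun i _ => ?_
    rcases lt_trichotomy (τ i) i with h | h | h
    · simp [ht, hg, h.ne, h.not_gt]
    · simp [ht, hg, h, ← mul_sum, sum_pow_val_add_self_eq_zero]
    · simp [ht, hg, h, h.ne', sum_ite_eq_zero_pow]
  rw [← hgt, prod_univ_sum]
  refine sum_nbij' (fun z i => if i ≤ τ i then z i else 0)
    (fun p i => if i ≤ τ i then p i else -p (τ i)) ?_ ?_ ?_ ?_ ?_
  · intro z hz
    simp only [mem_filter, mem_univ, true_and] at hz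
    rw [Fintype.mem_piFinset]
    intro i
    have hi := hz i
    rcases lt_trichotomy (τ i) i with h | h | h
    · simp [ht, h.ne, h.not_gt, h.not_ge]
    · rw [h] at hi
      simp [ht, h, hi]
    · simp [ht, h, h.ne']
  · intro p hp
    rw [Fintype.mem_piFinset] at hp
    simp only [mem_filter, mem_univ, true_and]
    intro i
    have hi := hp i
    rcases lt_trichotomy (τ i) i with h | h | h
    · simp [h2, h.le, h.not_ge]
    · simpa [ht, h] using hi
    · simp [h2, h.le, h.not_ge]
  · intro z hz
    simp only [mem_filter, mem_univ, true_and] at hz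
    funext i
    by_cases h : i ≤ τ i
    · simp [h]
    · simp only [h, if_false, h2, (not_le.mp h).le, if_true]
      exact neg_eq_of_add_eq_zero_left (hz i)
  · intro p hp
    rw [Fintype.mem_piFinset] at hp
    funext i
    by_cases h : i ≤ τ i
    · simp [h]
    · have hi := hp i
      simp only [ht, (not_le.mp h).ne, (not_le.mp h).not_gt, if_false, mem_singleton] at hi
      simp [h, hi]
  · intro z hz
    simp only [mem_filter, mem_univ, true_and] at hz
    rw [weight_eq_prod τ hτ z hz, prod_filter, prod_filter, ← prod_mul_distrib]
    refine prod_congr rfl fun i _ => ?_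
    rcases lt_trichotomy (τ i) i with h | h | h
    · simp [hg, h.ne, h.not_gt]
    · simp [hg, h]
    · simp [hg, h, h.le, h.ne']

theorem card_fixed_add_two_mul_card_lt {n : ℕ} (τ : Equiv.Perm (Fin n)) (hτ : τ * τ = 1) :
    #{i | τ i = i} + 2 * #{i | i < τ i} = n := by
  have := prod_univ_eq_of_mul_self τ hτ (fun _ => Multiplicative.ofAdd (1 : ℕ))
  have := congrArg Multiplicative.toAdd this
  simp at this
  omega

theorem cycleType_eq_replicate_two_iff {n : ℕ} (τ : Equiv.Perm (Fin n)) (k : ℕ) :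
    τ.cycleType = Multiset.replicate k 2 ↔ τ * τ = 1 ∧ #{i | i < τ i} = k := by
  have key : τ * τ = 1 → τ.cycleType = Multiset.replicate #{i | i < τ i} 2 := by
    intro hτ
    have h1 : τ.cycleType = Multiset.replicate (Multiset.card τ.cycleType) 2 := by
      rw [Multiset.eq_replicate]
      refine ⟨rfl, fun m hm => ?_⟩
      have h1 := Equiv.Perm.two_le_of_mem_cycleType hm
      have h2 := (Equiv.Perm.dvd_of_mem_cycleType hm).trans
        (orderOf_dvd_of_pow_eq_one (n := 2) (by rw [pow_two, hτ]))
      exact le_antisymm (Nat.le_of_dvd two_pos h2) h1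
    have hs := τ.sum_cycleType
    rw [h1, Multiset.sum_replicate, smul_eq_mul] at hs
    have hc := card_fixed_add_two_mul_card_lt τ hτ
    have hsupp : #{i | τ i = i} + #τ.support = n := by
      have := card_filter_add_card_filter_not (s := univ) (fun i => τ i = i)
      rw [card_univ, Fintype.card_fin] at this
      exact this
    rw [h1]
    congr 1
    omega
  constructor
  · intro h
    have hτ : τ * τ = 1 := by
      rw [← pow_two, ← orderOf_dvd_iff_pow_eq_one, ← Equiv.Perm.lcm_cycleType, h,
        Multiset.lcm_dvd]
      intro b hb
      rw [Multiset.eq_of_mem_replicate hb]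
    refine ⟨hτ, ?_⟩
    rw [key hτ] at h
    exact Multiset.replicate_left_injective 2 h
  · rintro ⟨hτ, rfl⟩
    exact key hτ

theorem multinomialZ_mul_factorial_div {n k : ℕ} (hk : 2 * k ≤ n) :
    ((k.factorial : ℚ) * (multinomialZ n [(k : ℤ), (k : ℤ), ((n - 2 * k : ℕ) : ℤ)] : ℚ)) / 2 ^ k =
      (#{τ : Equiv.Perm (Fin n) | τ * τ = 1 ∧ #{i | i < τ i} = k} : ℚ) := by
  have hcard := Equiv.Perm.card_of_cycleType_mul_eq (Fin n) (Multiset.replicate k 2)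
  have hs : (univ.filter fun τ : Equiv.Perm (Fin n) => τ.cycleType = Multiset.replicate k 2) =
      ({τ : Equiv.Perm (Fin n) | τ * τ = 1 ∧ #{i | i < τ i} = k} : Finset _) :=
    filter_congr fun τ _ => cycleType_eq_replicate_two_iff τ k
  have hm : multinomialZ n [(k : ℤ), (k : ℤ), ((n - 2 * k : ℕ) : ℤ)] =
      n.factorial / (k.factorial * (k.factorial * (n - 2 * k).factorial)) := by
    rw [multinomialZ, if_pos]
    · simp
    · constructor
      · simp
      · simp; omega
  have hprod : ∏ m ∈ (Multiset.replicate k 2).toFinset,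
      ((Multiset.replicate k 2).count m).factorial = k.factorial := by
    rcases Nat.eq_zero_or_pos k with rfl | hk0
    · simp
    · rw [Multiset.toFinset_replicate, if_neg hk0.ne', prod_singleton,
        Multiset.count_replicate_self]
  have hd1 : k.factorial * (k.factorial * (n - 2 * k).factorial) ∣ n.factorial := by
    rw [← mul_assoc]
    exact (mul_dvd_mul_right (Nat.factorial_mul_factorial_dvd_factorial_add k k) _).trans
      (by simpa [← two_mul, hk] using Nat.factorial_mul_factorial_dvd_factorial hk)
  have hf : ∀ m : ℕ, (m.factorial : ℚ) ≠ 0 := fun m => Nat.cast_ne_zero.mpr m.factorial_ne_zero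
  rw [hprod, Multiset.prod_replicate, Multiset.sum_replicate, smul_eq_mul, mul_comm k 2,
    Fintype.card_fin, if_pos ⟨hk, fun a ha => (Multiset.eq_of_mem_replicate ha).ge⟩, hs] at hcard
  rw [hm, Nat.cast_div hd1 (by positivity), ← hcard]
  push_cast
  have := hf k
  have := hf (n - 2 * k)
  field_simp

/-- In `ℚ[u,v,w]`,
`f_{r,1,n} = Σ_{j=⌈n/2⌉}^{n} (n−j)!·C(n; n−j, n−j, 2j−n)·u^{2j−n}·(v + (r−1)wʳ)^{n−j}·μ_r^{2j−n} / 2^{n−j}`. -/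
theorem fpoly_explicit (r n : ℕ) [NeZero r] (hr : 1 ≤ r) :
    fpolyQ r 1 n =
      ∑ j ∈ Finset.Icc ((n + 1) / 2) n,
        MvPolynomial.C
            ((((n - j).factorial : ℚ) *
              (multinomialZ n [(n : ℤ) - j, (n : ℤ) - j, 2 * (j : ℤ) - n] : ℚ)) / 2 ^ (n - j)) *
          X 0 ^ (2 * j - n) *
          (X 1 + ((r - 1 : ℕ) : MvPolynomial (Fin 3) ℚ) * X 2 ^ r) ^ (n - j) *
          muQ r ^ (2 * j - n) := by
  have h1 : fpolyQ r 1 n = ∑ τ : Equiv.Perm (Fin n) with τ * τ = 1,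
      (X 0 * muQ r) ^ #{i | τ i = i} *
        (X 1 + ((r - 1 : ℕ) : MvPolynomial (Fin 3) ℚ) * X 2 ^ r) ^ #{i | i < τ i} := by
    rw [fpolyQ, Fintype.sum_prod_type_right, sum_filter]
    refine sum_congr rfl fun τ _ => ?_
    simp only [isCPInvolution_iff, one_dvd, and_true]
    split_ifs with hτ
    · rw [← sum_colorings τ hτ, sum_filter]
      simp only [hτ, true_and]
    · simp [hτ]
  have hmaps : ∀ τ ∈ ({τ | τ * τ = 1} : Finset (Equiv.Perm (Fin n))),
      n - #{i | i < τ i} ∈ Finset.Icc ((n + 1) / 2) n := by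
    intro τ hτ
    have := card_fixed_add_two_mul_card_lt τ (mem_filter.mp hτ).2
    rw [Finset.mem_Icc]
    omega
  rw [h1, ← sum_fiberwise_of_maps_to hmaps]
  refine sum_congr rfl fun j hj => ?_
  rw [Finset.mem_Icc] at hj
  have e1 : (n : ℤ) - j = ((n - j : ℕ) : ℤ) := by omega
  have e2 : 2 * (j : ℤ) - n = ((n - 2 * (n - j) : ℕ) : ℤ) := by omega
  rw [e1, e2, multinomialZ_mul_factorial_div (by omega), filter_filter]
  have hs : ({τ : Equiv.Perm (Fin n) | τ * τ = 1 ∧ n - #{i | i < τ i} = j} : Finset _) =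
      ({τ : Equiv.Perm (Fin n) | τ * τ = 1 ∧ #{i | i < τ i} = n - j} : Finset _) := by
    refine filter_congr fun τ _ => and_congr_right fun hτ => ?_
    have := card_fixed_add_two_mul_card_lt τ hτ
    omega
  have hterm : ∀ τ ∈ ({τ : Equiv.Perm (Fin n) | τ * τ = 1 ∧ #{i | i < τ i} = n - j} : Finset _),
      (X 0 * muQ r) ^ #{i | τ i = i} *
        (X 1 + ((r - 1 : ℕ) : MvPolynomial (Fin 3) ℚ) * X 2 ^ r) ^ #{i | i < τ i} =
      (X 0 * muQ r) ^ (2 * j - n) *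
        (X 1 + ((r - 1 : ℕ) : MvPolynomial (Fin 3) ℚ) * X 2 ^ r) ^ (n - j) := by
    intro τ hτ
    obtain ⟨hτ, hk⟩ := (mem_filter.mp hτ).2
    have := card_fixed_add_two_mul_card_lt τ hτ
    rw [hk, show #{i | τ i = i} = 2 * j - n by omega]
  rw [hs, sum_congr rfl hterm, sum_const, nsmul_eq_mul, map_natCast, mul_pow]
  ring
end

section
/- Let r ≥ 1 be odd, p ≥ 1 with p | r, and n ≥ 0. Then in ℚ[u,v,w], f_{r,p,n}(u,v,w) = Σ_{j=⌈n/2⌉}^{n} (n−j)!·C(n; n−j, n−j, 2j−n)·u^{2j−n}·(v + (r−1)w^r)^{n−j} / 2^{n−j}. -/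
open Finset MvPolynomial

section InvolutivePerm

variable {n : ℕ} {τ : Equiv.Perm (Fin n)}

theorem apply_apply_of_mul_self_eq_one (hτ : τ * τ = 1) (i : Fin n) : τ (τ i) = i := by
  rw [← Equiv.Perm.mul_apply, hτ, Equiv.Perm.one_apply]

theorem sum_eq_sum_excedance_add_sum_fixed {M : Type*} [AddCommMonoid M] (hτ : τ * τ = 1)
    (f : Fin n → M) :
    ∑ i, f i = ∑ i : {i // i < τ i}, (f i + f (τ i)) + ∑ i with τ i = i, f i := by
  have hinv := apply_apply_of_mul_self_eq_one hτ
  have hlt : ∑ i with τ i < i, f i = ∑ i with i < τ i, f (τ i) := by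
    refine Finset.sum_nbij' τ τ ?_ ?_ ?_ ?_ ?_ <;> simp [hinv]
  have hsplit : ∀ i, f i = (if i < τ i then f i else 0) + (if τ i < i then f i else 0) +
      (if τ i = i then f i else 0) := fun i ↦ by
    rcases lt_trichotomy i (τ i) with h | h | h
    · simp [h, h.not_gt, h.ne']
    · simp [← h]
    · simp [h, h.not_gt, h.ne]
  rw [Finset.sum_congr rfl fun i _ ↦ hsplit i, Finset.sum_add_distrib, Finset.sum_add_distrib,
    ← Finset.sum_filter, ← Finset.sum_filter, ← Finset.sum_filter, hlt, ← Finset.sum_add_distrib,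
    Finset.sum_subtype (p := fun i ↦ i < τ i) _ (by simp)]

theorem two_mul_card_excedance_add_card_fixed (hτ : τ * τ = 1) :
    2 * Fintype.card {i // i < τ i} + Nat.card {i // τ i = i} = n := by
  have h := sum_eq_sum_excedance_add_sum_fixed hτ fun _ ↦ 1
  simp only [Finset.sum_const, Finset.card_univ, Fintype.card_fin, smul_eq_mul, mul_one] at h
  rw [Nat.card_eq_fintype_card, Fintype.card_subtype fun i ↦ τ i = i]
  lia

theorem cycleType_eq_replicate_card_excedance (hτ : τ * τ = 1) :
    τ.cycleType = Multiset.replicate (Fintype.card {i // i < τ i}) 2 := by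
  have h2 : τ.cycleType = Multiset.replicate τ.cycleType.card 2 :=
    Multiset.eq_replicate_card.2 <| Equiv.Perm.pow_prime_eq_one_iff.1 (by rw [sq, hτ])
  have hsum : τ.cycleType.card * 2 = τ.support.card := by
    rw [← Equiv.Perm.sum_cycleType, h2]; simp
  have hsupp : τ.support.card + Nat.card {i // τ i = i} = n := by
    rw [Nat.card_eq_fintype_card, Fintype.card_subtype, Equiv.Perm.support, add_comm]
    simpa using Finset.card_filter_add_card_filter_not (s := Finset.univ) (fun i ↦ τ i = i)
  have := two_mul_card_excedance_add_card_fixed hτ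
  rw [h2]
  congr 1
  lia

theorem card_involutive_perm_with_card_excedance_mul_eq (n k : ℕ) (hk : 2 * k ≤ n) :
    #{τ : Equiv.Perm (Fin n) | τ * τ = 1 ∧ Fintype.card {i // i < τ i} = k} *
      ((n - 2 * k).factorial * 2 ^ k * k.factorial) = n.factorial := by
  have h := Equiv.Perm.card_of_cycleType_mul_eq (Fin n) (Multiset.replicate k 2)
  rw [if_pos ⟨by simpa [mul_comm] using hk,
    fun a ha ↦ (Multiset.eq_of_mem_replicate ha).ge⟩] at h
  have hprod : ∏ m ∈ (Multiset.replicate k 2).toFinset,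
      ((Multiset.replicate k 2).count m).factorial = k.factorial := by
    rcases k.eq_zero_or_pos with rfl | hk0
    · simp
    · simp [Multiset.toFinset_replicate, hk0.ne']
  rw [hprod, Multiset.sum_replicate, Multiset.prod_replicate, Fintype.card_fin, smul_eq_mul,
    mul_comm k 2] at h
  rw [← h]
  congr 2
  ext τ
  simp only [Finset.mem_filter, Finset.mem_univ, true_and]
  refine ⟨fun ⟨hτ, hc⟩ ↦ hc ▸ cycleType_eq_replicate_card_excedance hτ, fun hc ↦ ?_⟩
  have hτ : τ * τ = 1 := by
    rw [← sq, Equiv.Perm.pow_prime_eq_one_iff]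
    exact fun c hcm ↦ Multiset.eq_of_mem_replicate (hc ▸ hcm)
  refine ⟨hτ, ?_⟩
  simpa using congrArg Multiset.card ((cycleType_eq_replicate_card_excedance hτ).symm.trans hc)

end InvolutivePerm

section Coloring

variable {r n : ℕ} {τ : Equiv.Perm (Fin n)}

theorem isCPInvolution_mk_iff (z : Fin n → ZMod r) (hτ : τ * τ = 1) :
    IsCPInvolution (z, τ) ↔ ∀ i, z (τ i) = -z i := by
  have hinv : τ⁻¹ = τ := inv_eq_of_mul_eq_one_left hτ
  simp [IsCPInvolution, cpMul, cpOne, hτ, hinv, funext_iff, eq_neg_iff_add_eq_zero, add_comm]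

theorem IsCPInvolution.mul_self_eq_one {π : ColoredPerm r n} (h : IsCPInvolution π) :
    π.2 * π.2 = 1 :=
  congrArg Prod.snd h

theorem ZMod.eq_zero_of_eq_neg_of_odd (hodd : Odd r) {a : ZMod r} (h : a = -a) : a = 0 := by
  have h2 : (2 : ZMod r) * a = 0 := by rw [two_mul]; exact eq_neg_iff_add_eq_zero.1 h
  have hu : IsUnit ((2 : ℕ) : ZMod r) :=
    (ZMod.isUnit_iff_coprime 2 r).2 (Nat.coprime_two_left.2 hodd)
  exact (hu.mul_right_eq_zero).1 (by exact_mod_cast h2)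

theorem csum_eq_sum_excedance [NeZero r] (hodd : Odd r) (hτ : τ * τ = 1) {z : Fin n → ZMod r}
    (hz : ∀ i, z (τ i) = -z i) :
    csum (z, τ) = ∑ i : {i // i < τ i}, if z i = 0 then 0 else r := by
  rw [csum, sum_eq_sum_excedance_add_sum_fixed hτ, Finset.sum_eq_zero (s := Finset.univ.filter _),
    add_zero]
  · refine Finset.sum_congr rfl fun i _ ↦ ?_
    dsimp only
    rw [hz, ZMod.neg_val]
    have := (ZMod.val_lt (z i)).le
    split_ifs with h
    · simp [h]
    · lia
  · intro i hi
    rw [Finset.mem_filter] at hi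
    have := hz i
    rw [hi.2] at this
    simp [ZMod.eq_zero_of_eq_neg_of_odd hodd this]

theorem excA_eq_sum_excedance {z : Fin n → ZMod r} (hz : ∀ i, z (τ i) = -z i) :
    excA (z, τ) = ∑ i : {i // i < τ i}, if z i = 0 then 1 else 0 := by
  rw [excA, ← Finset.card_filter, Nat.card_eq_fintype_card, Fintype.card_subtype,
    ← Finset.card_map (Function.Embedding.subtype _)]
  congr 1
  ext i
  simp only [Finset.mem_filter, Finset.mem_univ, true_and, Finset.mem_map, hz, neg_eq_zero,
    Function.Embedding.subtype_apply, Subtype.exists, exists_and_left, exists_prop,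
    exists_eq_right_right]
  constructor
  · exact fun h ↦ h.2
  · exact fun h ↦ ⟨by have := (τ i).isLt; have := h.2; lia, h⟩

theorem sum_antisymmetric_coloring {M : Type*} [AddCommMonoid M] [NeZero r] (hodd : Odd r)
    (hτ : τ * τ = 1) (F : ({i // i < τ i} → ZMod r) → M) :
    ∑ z : Fin n → ZMod r with ∀ i, z (τ i) = -z i, F (fun i ↦ z i) = ∑ y, F y := by
  have hinv := apply_apply_of_mul_self_eq_one hτ
  refine Finset.sum_nbij (fun z i ↦ z i) (fun _ _ ↦ Finset.mem_univ _) ?_ ?_ fun _ _ ↦ rfl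
  · intro z hz z' hz' h
    simp only [Finset.coe_filter, Finset.mem_univ, true_and, Set.mem_ofPred_eq] at hz hz'
    have hlt : ∀ i, i < τ i → z i = z' i := fun i hi ↦ congrFun h ⟨i, hi⟩
    ext1 i
    rcases lt_trichotomy i (τ i) with hi | hi | hi
    · exact hlt i hi
    · have h1 := hz i
      have h2 := hz' i
      rw [← hi] at h1 h2
      rw [ZMod.eq_zero_of_eq_neg_of_odd hodd h1, ZMod.eq_zero_of_eq_neg_of_odd hodd h2]
    · have := hlt (τ i) (by rwa [hinv])
      rwa [hz, hz', neg_inj] at this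
  · intro y _
    refine ⟨fun i ↦ if h : i < τ i then y ⟨i, h⟩ else
      if h : τ i < i then -y ⟨τ i, by rwa [hinv]⟩ else 0, ?_, ?_⟩
    · simp only [Finset.coe_filter, Finset.mem_univ, true_and, Set.mem_ofPred_eq]
      intro i
      rcases lt_trichotomy i (τ i) with hi | hi | hi
      · simp [hinv, hi, hi.not_gt]
      · simp [← hi]
      · simp [hinv, hi, hi.not_gt]
    · ext1 i
      simp [i.2]

theorem sum_involutive_coloring [NeZero r] {p : ℕ} (hodd : Odd r) (hpr : p ∣ r)
    (hτ : τ * τ = 1) {R : Type*} [CommSemiring R] (u v w : R) :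
    (∑ z : Fin n → ZMod r, if IsCPInvolution (z, τ) ∧ p ∣ csum (z, τ) then
      u ^ fixc (z, τ) * v ^ excA (z, τ) * w ^ csum (z, τ) else 0) =
      u ^ (n - 2 * Fintype.card {i // i < τ i}) *
        (v + ((r - 1 : ℕ) : R) * w ^ r) ^ Fintype.card {i // i < τ i} := by
  have hfix : Nat.card {i // τ i = i} = n - 2 * Fintype.card {i // i < τ i} := by
    have := two_mul_card_excedance_add_card_fixed hτ
    lia
  have hcolor : ∑ c : ZMod r, (if c = 0 then v else w ^ r) = v + ((r - 1 : ℕ) : R) * w ^ r := by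
    rw [← Finset.add_sum_erase _ _ (Finset.mem_univ 0), if_pos rfl,
      Finset.sum_congr rfl fun c hc ↦ if_neg (Finset.ne_of_mem_erase hc)]
    simp [ZMod.card]
  rw [← hcolor, ← Finset.card_univ, ← Finset.prod_const, Finset.prod_univ_sum,
    Fintype.piFinset_univ, ← sum_antisymmetric_coloring hodd hτ, Finset.mul_sum, Finset.sum_filter]
  refine Finset.sum_congr rfl fun z _ ↦ ?_
  have hiff := isCPInvolution_mk_iff z hτ
  by_cases hz : ∀ i, z (τ i) = -z i
  · have hdvd : p ∣ csum (z, τ) := by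
      rw [csum_eq_sum_excedance hodd hτ hz]
      exact Finset.dvd_sum fun i _ ↦ by split_ifs <;> simp [hpr]
    rw [if_pos ⟨hiff.2 hz, hdvd⟩, if_pos hz, csum_eq_sum_excedance hodd hτ hz, excA_eq_sum_excedance hz,
      mul_assoc, ← Finset.prod_pow_eq_pow_sum, ← Finset.prod_pow_eq_pow_sum,
      ← Finset.prod_mul_distrib, fixc, hfix]
    congr 1
    refine Finset.prod_congr rfl fun i _ ↦ ?_
    split_ifs <;> simp
  · rw [if_neg fun h ↦ hz (hiff.1 h.1), if_neg hz]

end Coloring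

theorem fpolyQ_eq_sum_card_excedance {r : ℕ} (p n : ℕ) [NeZero r] (hodd : Odd r) (hpr : p ∣ r) :
    fpolyQ r p n = ∑ k ∈ Finset.range (n / 2 + 1),
      (#{τ : Equiv.Perm (Fin n) | τ * τ = 1 ∧ Fintype.card {i // i < τ i} = k} : ℕ) •
        ((X 0 : MvPolynomial (Fin 3) ℚ) ^ (n - 2 * k) *
          (X 1 + ((r - 1 : ℕ) : MvPolynomial (Fin 3) ℚ) * X 2 ^ r) ^ k) := by
  rw [fpolyQ, Fintype.sum_prod_type_right]
  have hstep : ∀ τ : Equiv.Perm (Fin n),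
      (∑ z : Fin n → ZMod r, if IsCPInvolution (z, τ) ∧ p ∣ csum (z, τ) then
        (X 0 : MvPolynomial (Fin 3) ℚ) ^ fixc (z, τ) * X 1 ^ excA (z, τ) * X 2 ^ csum (z, τ)
        else 0) = if τ * τ = 1 then X 0 ^ (n - 2 * Fintype.card {i // i < τ i}) *
        (X 1 + ((r - 1 : ℕ) : MvPolynomial (Fin 3) ℚ) * X 2 ^ r) ^ Fintype.card {i // i < τ i}
        else 0 := fun τ ↦ by
    split_ifs with hτ
    · exact sum_involutive_coloring hodd hpr hτ _ _ _
    · exact Finset.sum_eq_zero fun z _ ↦ if_neg fun h ↦ hτ h.1.mul_self_eq_one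
  rw [Finset.sum_congr rfl fun τ _ ↦ hstep τ, ← Finset.sum_filter,
    ← Finset.sum_fiberwise_of_maps_to (t := Finset.range (n / 2 + 1))
      (g := fun τ ↦ Fintype.card {i // i < τ i})]
  · refine Finset.sum_congr rfl fun k _ ↦ ?_
    rw [Finset.filter_filter, ← Finset.sum_const]
    refine Finset.sum_congr rfl fun τ hτ ↦ ?_
    rw [(Finset.mem_filter.1 hτ).2.2]
  · intro τ hτ
    have := two_mul_card_excedance_add_card_fixed (Finset.mem_filter.1 hτ).2
    rw [Finset.mem_range]
    lia

theorem card_involutive_perm_eq_multinomialZ (m k : ℕ) :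
    (#{τ : Equiv.Perm (Fin (m + 2 * k)) |
        τ * τ = 1 ∧ Fintype.card {i // i < τ i} = k} : ℚ) =
      k.factorial * multinomialZ (m + 2 * k : ℕ) [(k : ℤ), (k : ℤ), (m : ℤ)] / 2 ^ k := by
  have hcard := card_involutive_perm_with_card_excedance_mul_eq (m + 2 * k) k (by lia)
  have hdvd : k.factorial * (k.factorial * m.factorial) ∣ (m + 2 * k).factorial := by
    rw [show m + 2 * k = k + (k + m) by lia]
    exact (mul_dvd_mul_left _ (Nat.factorial_mul_factorial_dvd_factorial_add k m)).trans
      (Nat.factorial_mul_factorial_dvd_factorial_add _ _)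
  rw [multinomialZ, if_pos ⟨by simp, by simp; ring⟩]
  simp only [List.map_cons, List.map_nil, List.prod_cons, List.prod_nil, Int.toNat_natCast, mul_one]
  rw [Nat.cast_div hdvd (by positivity), ← hcard, Nat.add_sub_cancel]
  push_cast
  field_simp

/-- For odd `r ≥ 1` and `p ≥ 1` with `p ∣ r`, in `ℚ[u,v,w]`,
`f_{r,p,n} = Σ_{j=⌈n/2⌉}^{n} (n−j)!·C(n; n−j, n−j, 2j−n)·u^{2j−n}·(v + (r−1)wʳ)^{n−j} / 2^{n−j}`. -/
theorem fpoly_explicit_odd (r p n : ℕ) [NeZero r] (hr : 1 ≤ r) (hodd : Odd r)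
    (hp : 1 ≤ p) (hpr : p ∣ r) :
    fpolyQ r p n =
      ∑ j ∈ Finset.Icc ((n + 1) / 2) n,
        MvPolynomial.C
            ((((n - j).factorial : ℚ) *
              (multinomialZ n [(n : ℤ) - j, (n : ℤ) - j, 2 * (j : ℤ) - n] : ℚ)) / 2 ^ (n - j)) *
          X 0 ^ (2 * j - n) *
          (X 1 + ((r - 1 : ℕ) : MvPolynomial (Fin 3) ℚ) * X 2 ^ r) ^ (n - j) := by
  rw [fpolyQ_eq_sum_card_excedance p n hodd hpr]
  refine Finset.sum_nbij' (fun k ↦ n - k) (fun j ↦ n - j) ?_ ?_ ?_ ?_ ?_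
  · intro k hk
    rw [Finset.mem_range] at hk
    rw [Finset.mem_Icc]
    lia
  · intro j hj
    rw [Finset.mem_Icc] at hj
    rw [Finset.mem_range]
    lia
  · intro k hk
    rw [Finset.mem_range] at hk
    lia
  · intro j hj
    rw [Finset.mem_Icc] at hj
    lia
  · intro k hk
    rw [Finset.mem_range] at hk
    obtain ⟨m, rfl⟩ : ∃ m, n = m + 2 * k := ⟨n - 2 * k, by lia⟩
    have hsub : m + 2 * k - (m + 2 * k - k) = k := by lia
    have hm : 2 * (m + 2 * k - k) - (m + 2 * k) = m := by lia
    have hkZ : ((m + 2 * k : ℕ) : ℤ) - (m + 2 * k - k : ℕ) = k := by lia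
    have hmZ : 2 * ((m + 2 * k - k : ℕ) : ℤ) - (m + 2 * k : ℕ) = m := by lia
    rw [hsub, hm, hkZ, hmZ, ← card_involutive_perm_eq_multinomialZ, Nat.add_sub_cancel,
      nsmul_eq_mul, map_natCast, mul_assoc]
end
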